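/- Let d ≥ 1 and 0 < μ < d. The inversion map (wf)(x) = |x|^{-2μ} f(-x/|x|²) preserves the norm ‖f‖²_μ = ∫_{ℝ^d} |Ff(ξ)|² |ξ|^{d - 2μ} dξ up to a constant, i.e. the principal series action of the Weyl element on the complementary series space is bounded. -/

import Mathlib

open MeasureTheory
open scoped FourierTransform ENNReal NNReal

section Helpers

variable {d : ℕ}

abbrev EE (d : ℕ) := EuclideanSpace ℝ (Fin d)

noncomputable def sig {d : ℕ} (x : EE d) : EE d := -((‖x‖ ^ 2)⁻¹ • x)

lemma norm_sig {d : ℕ} (x : EE d) : ‖sig x‖ = ‖x‖⁻¹ := by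
  by_cases hx : x = 0
  · simp [sig, hx]
  · have : ‖x‖ ≠ 0 := by simpa using hx
    rw [sig, norm_neg, norm_smul, norm_inv, norm_pow, norm_norm]
    field_simp

lemma sig_sig {d : ℕ} (x : EE d) : sig (sig x) = x := by
  by_cases hx : x = 0
  · simp [sig, hx]
  · have : ‖x‖ ≠ 0 := by simpa using hx
    conv_lhs => rw [sig, norm_sig]
    rw [sig, smul_neg, neg_neg, smul_smul]
    field_simp
    simp

lemma sig_ne_zero {d : ℕ} {x : EE d} (hx : x ≠ 0) : sig x ≠ 0 := by
  rw [← norm_ne_zero_iff, norm_sig]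
  simpa using hx

lemma norm_sig_sub {d : ℕ} {x y : EE d} (hx : x ≠ 0) (hy : y ≠ 0) :
    ‖sig x - sig y‖ = ‖x - y‖ * ‖x‖⁻¹ * ‖y‖⁻¹ := by
  have := dist_div_norm_sq_smul hx hy 1
  rw [dist_eq_norm, dist_eq_norm] at this
  rw [sig, sig, neg_sub_neg, ← norm_neg, neg_sub]
  convert this using 1
  · simp
  · field_simp

lemma measurable_sig {d : ℕ} : Measurable (sig (d := d)) := by
  unfold sig; fun_prop

lemma image_sig {d : ℕ} : sig (d := d) '' {0}ᶜ = {0}ᶜ := by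
  ext y
  constructor
  · rintro ⟨x, hx, rfl⟩
    exact sig_ne_zero hx
  · intro hy
    exact ⟨sig y, sig_ne_zero hy, sig_sig y⟩

lemma injOn_sig {d : ℕ} (s : Set (EE d)) : Set.InjOn (sig (d := d)) s := fun x _ y _ h => by
  rw [← sig_sig x, h, sig_sig]

lemma hasFDerivAt_sig {d : ℕ} {x : EE d} (hx : x ≠ 0) :
    ∃ A : EE d →L[ℝ] EE d, HasFDerivAt sig A x ∧ |A.det| = ‖x‖ ^ (-(2 * (d:ℝ))) := by
  have h := (EuclideanGeometry.hasFDerivAt_inversion (R := 1) hx).neg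
  refine ⟨_, h.congr_of_eventuallyEq ?_, ?_⟩
  · refine Filter.Eventually.of_forall fun y => ?_
    simp [sig, EuclideanGeometry.inversion]
  · have hn : 0 < ‖x‖ := by simpa using hx
    rw [← neg_smul, ContinuousLinearMap.det, ContinuousLinearMap.toLinearMap_smul,
      LinearMap.det_smul, abs_mul, finrank_euclideanSpace_fin]
    have : |LinearMap.det (((ℝ ∙ (x - 0))ᗮ.reflection : EE d →L[ℝ] EE d) : EE d →ₗ[ℝ] EE d)| = 1 := by
      have h2 := ((ℝ ∙ (x - 0))ᗮ).det_reflection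
      have h3 := congrArg abs h2
      rw [abs_pow, abs_neg, abs_one, one_pow] at h3
      exact h3
    rw [this]
    simp
    rw [Real.rpow_neg hn.le, mul_comm 2, Real.rpow_mul hn.le]
    norm_cast
    rw [← pow_mul, ← pow_mul, mul_comm]

lemma exists_deriv_sig {d : ℕ} : ∃ A : EE d → (EE d →L[ℝ] EE d), (∀ x ∈ ({0}ᶜ : Set (EE d)),
    HasFDerivWithinAt sig (A x) {0}ᶜ x) ∧ ∀ x ∈ ({0}ᶜ : Set (EE d)), |(A x).det| = ‖x‖ ^ (-(2 * (d:ℝ))) := by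
  choose! A hA using fun (x : EE d) (hx : x ∈ ({0}ᶜ : Set (EE d))) => hasFDerivAt_sig hx
  exact ⟨A, fun x hx => (hA x hx).1.hasFDerivWithinAt, fun x hx => (hA x hx).2⟩


lemma ae_ne (hd : 1 ≤ d) (y : EE d) : ∀ᵐ x : EE d, x ≠ y := by
  have : Nonempty (Fin d) := ⟨⟨0, hd⟩⟩
  exact Measure.ae_ne volume y

lemma restrict_compl_zero (hd : 1 ≤ d) : (volume : Measure (EE d)).restrict {0}ᶜ = volume := by
  rw [Measure.restrict_eq_self_of_ae_mem]
  exact ae_ne hd 0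

lemma lintegral_sig (hd : 1 ≤ d) (F : EE d → ℝ≥0∞) :
    ∫⁻ x, ENNReal.ofReal (‖x‖ ^ (-(2 * (d:ℝ)))) * F (sig x) = ∫⁻ x, F x := by
  obtain ⟨A, hA, hdet⟩ := exists_deriv_sig (d := d)
  have := lintegral_image_eq_lintegral_abs_det_fderiv_mul volume
    (MeasurableSet.singleton (0 : EE d)).compl hA (injOn_sig _) F
  rw [image_sig] at this
  have h2 : ∫⁻ x in {0}ᶜ, ENNReal.ofReal |(A x).det| * F (sig x)
      = ∫⁻ x in {0}ᶜ, ENNReal.ofReal (‖x‖ ^ (-(2 * (d:ℝ)))) * F (sig x) :=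
    setLIntegral_congr_fun (MeasurableSet.singleton (0 : EE d)).compl
      (fun x hx => by simp only [hdet x hx])
  rw [h2, restrict_compl_zero hd] at this
  exact this.symm

lemma integral_sig (hd : 1 ≤ d) (F : EE d → ℂ) :
    ∫ x, ((‖x‖ ^ (-(2 * (d:ℝ))) : ℝ) : ℂ) * F (sig x) = ∫ x, F x := by
  obtain ⟨A, hA, hdet⟩ := exists_deriv_sig (d := d)
  have := integral_image_eq_integral_abs_det_fderiv_smul volume
    (MeasurableSet.singleton (0 : EE d)).compl hA (injOn_sig _) F
  rw [image_sig] at this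
  have h2 : ∫ x in {0}ᶜ, |(A x).det| • F (sig x)
      = ∫ x in {0}ᶜ, (‖x‖ ^ (-(2 * (d:ℝ)))) • F (sig x) :=
    setIntegral_congr_fun (MeasurableSet.singleton (0 : EE d)).compl
      (fun x hx => by simp only [hdet x hx])
  rw [h2, restrict_compl_zero hd] at this
  rw [this]
  exact integral_congr_ae (Filter.Eventually.of_forall fun x => by simp [Complex.real_smul])


lemma fourier_flip {f g : EE d → ℂ} (hf : Integrable f) (hg : Integrable g) :
    ∫ ξ, 𝓕 f ξ * g ξ = ∫ x, f x * 𝓕 g x := by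
  simpa using! VectorFourier.integral_bilin_fourierIntegral_eq_flip (ContinuousLinearMap.mul ℂ ℂ)
    (L := innerₗ (EE d)) Real.continuous_fourierChar continuous_inner hf hg

lemma int_star {f : EE d → ℂ} (hf : Integrable f) : Integrable (fun x => star (f x)) :=
  ContinuousLinearMap.integrable_comp (Complex.conjCLE : ℂ →L[ℝ] ℂ) hf

lemma fourier_star (g : EE d → ℂ) (ξ : EE d) :
    𝓕 (fun x => star (g x)) ξ = star (𝓕 g (-ξ)) := by
  rw [Real.fourier_eq', Real.fourier_eq']
  have := integral_conj (μ := (volume : Measure (EE d)))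
    (f := fun v => Complex.exp (↑(-2 * Real.pi * inner ℝ v (-ξ)) * Complex.I) • g v)
  refine Eq.trans ?_ this
  congr 1
  ext v
  simp [← Complex.exp_conj, map_ofNat]

lemma fourier_star_neg (g : EE d → ℂ) (ξ : EE d) :
    𝓕 (fun x => star (g (-x))) ξ = star (𝓕 g ξ) := by
  rw [fourier_star (fun x => g (-x)), ← Real.fourierInv_eq_fourier_comp_neg,
    Real.fourierInv_eq_fourier_neg, neg_neg]

lemma continuous_fourier {g : EE d → ℂ} (hg : Integrable g) : Continuous (𝓕 g) :=
  VectorFourier.fourierIntegral_continuous Real.continuous_fourierChar continuous_inner hg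

lemma norm_fourier_le (g : EE d → ℂ) (ξ : EE d) : ‖𝓕 g ξ‖ ≤ ∫ x, ‖g x‖ :=
  VectorFourier.norm_fourierIntegral_le_integral_norm _ _ _ _ _

lemma integrable_gauss {t : ℝ} (ht : 0 < t) : 
    Integrable (fun ξ : EE d => Real.exp (-(Real.pi * ‖ξ‖ ^ 2 * t))) := by
  have h := GaussianFourier.integrable_cexp_neg_mul_sq_norm_add (V := EE d) (b := ((Real.pi * t : ℝ) : ℂ))
    (by simpa using by positivity) 0 0
  have h2 := h.re
  refine h2.congr (Filter.Eventually.of_forall fun ξ => ?_)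
  simp only [zero_mul, add_zero]
  rw [show (-((Real.pi * t : ℝ) : ℂ) * (‖ξ‖ : ℂ) ^ 2) = ((-(Real.pi * ‖ξ‖ ^ 2 * t) : ℝ) : ℂ) by push_cast; ring,
    ← Complex.ofReal_exp]
  rfl

lemma bdd_mul_int {g h : EE d → ℂ} (hg : Continuous g) (C : ℝ) (hC : ∀ x, ‖g x‖ ≤ C) (hh : Integrable h) :
    Integrable (fun x => g x * h x) :=
  hh.bdd_mul hg.aestronglyMeasurable (Filter.Eventually.of_forall hC)

/-- Gaussian-regularised Parseval. -/
lemma gauss_parseval {g : EE d → ℂ} (hg : Integrable g) {t : ℝ} (ht : 0 < t) :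
    ((∫ ξ, ‖𝓕 g ξ‖ ^ 2 * Real.exp (-(Real.pi * ‖ξ‖ ^ 2 * t)) : ℝ) : ℂ) =
      ∫ x, g x * ∫ y, star (g y) * ((t ^ (-((d:ℝ) / 2)) * Real.exp (-(Real.pi * ‖x - y‖ ^ 2 / t)) : ℝ) : ℂ) := by
  set G : EE d → ℂ := fun ξ => ((Real.exp (-(Real.pi * ‖ξ‖ ^ 2 * t)) : ℝ) : ℂ) with hG
  have hGi : Integrable G := (integrable_gauss ht).ofReal
  have hsg : Continuous (fun ξ => star (𝓕 g ξ)) := (continuous_fourier hg).star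
  have hψ : Integrable (fun ξ => star (𝓕 g ξ) * G ξ) :=
    bdd_mul_int hsg (∫ x, ‖g x‖) (fun x => by rw [norm_star]; exact norm_fourier_le g x) hGi
  have h1 : ((∫ ξ, ‖𝓕 g ξ‖ ^ 2 * Real.exp (-(Real.pi * ‖ξ‖ ^ 2 * t)) : ℝ) : ℂ) =
      ∫ ξ, 𝓕 g ξ * (star (𝓕 g ξ) * G ξ) := by
    rw [← integral_complex_ofReal]
    congr 1
    ext ξ
    rw [← mul_assoc, Complex.star_def, Complex.mul_conj, Complex.normSq_eq_norm_sq, hG]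
    push_cast
    rfl
  rw [h1, fourier_flip hg hψ]
  congr 1
  ext x
  congr 1
  have hgs : Integrable (fun y => star (g (-y))) := int_star hg.comp_neg
  set γ : EE d → ℂ := fun ξ => Complex.exp (-((Real.pi * t : ℝ) : ℂ) * (‖ξ‖ : ℂ) ^ 2 +
    2 * Real.pi * Complex.I * (inner ℝ (-x) ξ : ℝ)) with hγ
  have hbre : 0 < (((Real.pi * t : ℝ) : ℂ)).re := by simpa using by positivity
  have hγi : Integrable γ := GaussianFourier.integrable_cexp_neg_mul_sq_norm_add hbre _ _
  have h2 : 𝓕 (fun ξ => star (𝓕 g ξ) * G ξ) x = ∫ ξ, 𝓕 (fun y => star (g (-y))) ξ * γ ξ := by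
    rw [Real.fourier_eq']
    congr 1
    ext ξ
    rw [fourier_star_neg, smul_eq_mul, mul_left_comm, hγ, hG]
    congr 1
    simp only [Complex.ofReal_exp]
    rw [← Complex.exp_add]
    congr 1
    rw [inner_neg_left, real_inner_comm]
    push_cast
    ring
  rw [h2, fourier_flip hgs hγi, ← integral_neg_eq_self]
  congr 1
  ext y
  simp only [neg_neg]
  congr 1
  rw [hγ, fourier_gaussian_innerProductSpace' hbre, finrank_euclideanSpace_fin]
  have e1 : (Real.pi : ℂ) / ((Real.pi * t : ℝ) : ℂ) = ((t⁻¹ : ℝ) : ℂ) := by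
    push_cast
    field_simp [Real.pi_ne_zero]
  have e2 : ((t⁻¹ : ℝ) : ℂ) ^ ((d : ℂ) / 2) = ((t ^ (-((d:ℝ) / 2)) : ℝ) : ℂ) := by
    rw [Real.rpow_neg ht.le, ← Real.inv_rpow ht.le, Complex.ofReal_cpow (by positivity)]
    push_cast; rfl
  rw [e1, e2]
  push_cast
  congr 2
  rw [show -x - -y = -(x - y) by abel, norm_neg]
  field_simp [Real.pi_ne_zero]


lemma t_int1 {a r : ℝ} (ha : 0 < a) (hr : 0 < r) :
    ∫⁻ t in Set.Ioi (0:ℝ), ENNReal.ofReal (t ^ (a - 1) * Real.exp (-(r * t))) =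
      ENNReal.ofReal ((1 / r) ^ a * Real.Gamma a) := by
  have h := Real.integral_rpow_mul_exp_neg_mul_Ioi ha hr
  have hG := Real.Gamma_pos_of_pos ha
  rw [← h, ofReal_integral_eq_lintegral_ofReal]
  · apply Integrable.of_integral_ne_zero
    rw [h]
    positivity
  · filter_upwards [ae_restrict_mem measurableSet_Ioi] with t ht
    have : (0:ℝ) < t := ht
    simp only [Pi.zero_apply]; positivity

lemma t_int2' {b r : ℝ} (hb : 0 < b) (hr : 0 < r) :
    ∫ t in Set.Ioi (0:ℝ), t ^ (-b - 1) * Real.exp (-(r / t)) = (1 / r) ^ b * Real.Gamma b := by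
  rw [← Real.integral_rpow_mul_exp_neg_mul_Ioi hb hr]
  rw [← integral_comp_rpow_Ioi (fun t => t ^ (b - 1) * Real.exp (-(r * t))) (p := -1) (by norm_num)]
  refine setIntegral_congr_fun measurableSet_Ioi fun t ht => ?_
  have ht : (0:ℝ) < t := ht
  simp only [smul_eq_mul, abs_neg, abs_one, one_mul]
  rw [← Real.rpow_mul ht.le, ← mul_assoc, ← Real.rpow_add ht, Real.rpow_neg_one, div_eq_mul_inv]
  congr 2
  ring

lemma t_int2i {b r : ℝ} (hb : 0 < b) (hr : 0 < r) :
    IntegrableOn (fun t : ℝ => t ^ (-b - 1) * Real.exp (-(r / t))) (Set.Ioi (0:ℝ)) := by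
  have hG := Real.Gamma_pos_of_pos hb
  apply Integrable.of_integral_ne_zero
  rw [t_int2' hb hr]
  positivity

lemma t_int2 {b r : ℝ} (hb : 0 < b) (hr : 0 < r) :
    ∫⁻ t in Set.Ioi (0:ℝ), ENNReal.ofReal (t ^ (-b - 1) * Real.exp (-(r / t))) =
      ENNReal.ofReal ((1 / r) ^ b * Real.Gamma b) := by
  rw [← t_int2' hb hr, ofReal_integral_eq_lintegral_ofReal (t_int2i hb hr)]
  filter_upwards [ae_restrict_mem measurableSet_Ioi] with t ht
  have : (0:ℝ) < t := ht
  simp only [Pi.zero_apply]; positivity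

lemma const_split {b r : ℝ} (hr : 0 < r) : (1 / (Real.pi * r ^ 2)) ^ b * Real.Gamma b =
    ((1 / Real.pi) ^ b * Real.Gamma b) * r ^ (-(2 * b)) := by
  rw [show 1 / (Real.pi * r ^ 2) = (1 / Real.pi) * (r ^ 2)⁻¹ by field_simp,
    Real.mul_rpow (by positivity) (by positivity), Real.inv_rpow (by positivity),
    ← Real.rpow_natCast, ← Real.rpow_mul hr.le, Real.rpow_neg hr.le]
  push_cast
  ring

lemma ae_prod_ne (hd : 1 ≤ d) : ∀ᵐ p : EE d × EE d ∂(volume.prod volume), p.1 ≠ p.2 := by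
  have hm : MeasurableSet {p : EE d × EE d | p.1 ≠ p.2} :=
    (measurableSet_eq_fun measurable_fst measurable_snd).compl
  rw [Measure.ae_prod_iff_ae_ae hm]
  refine Filter.Eventually.of_forall fun x => ?_
  filter_upwards [ae_ne hd x] with y hy
  exact hy.symm

lemma enorm_star' (z : ℂ) : ‖star z‖ₑ = ‖z‖ₑ := by
  rw [← ofReal_norm, norm_star, ofReal_norm]

lemma energy_left (hd : 1 ≤ d) {g : EE d → ℂ} (hg : Integrable g) {a : ℝ} (ha : 0 < a) :
    ENNReal.ofReal ((1 / Real.pi) ^ a * Real.Gamma a) *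
      ∫⁻ ξ, ‖𝓕 g ξ‖ₑ ^ 2 * ENNReal.ofReal (‖ξ‖ ^ (-(2 * a))) =
    ∫⁻ t in Set.Ioi (0:ℝ), ENNReal.ofReal (t ^ (a - 1) *
      ∫ ξ, ‖𝓕 g ξ‖ ^ 2 * Real.exp (-(Real.pi * ‖ξ‖ ^ 2 * t))) := by
  have hc := continuous_fourier hg
  have hcm : Measurable (𝓕 g) := hc.measurable
  rw [← lintegral_const_mul _ (by fun_prop)]
  have h1 : ∀ t ∈ Set.Ioi (0:ℝ), ENNReal.ofReal (t ^ (a - 1) *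
      ∫ ξ, ‖𝓕 g ξ‖ ^ 2 * Real.exp (-(Real.pi * ‖ξ‖ ^ 2 * t))) =
      ∫⁻ ξ, ‖𝓕 g ξ‖ₑ ^ 2 * ENNReal.ofReal (t ^ (a - 1) * Real.exp (-(Real.pi * ‖ξ‖ ^ 2 * t))) := by
    intro t ht
    have ht : (0:ℝ) < t := ht
    rw [← integral_const_mul, ofReal_integral_eq_lintegral_ofReal]
    · congr 1
      ext ξ
      rw [mul_left_comm, ENNReal.ofReal_mul (by positivity), ENNReal.ofReal_pow (norm_nonneg _), ofReal_norm]
    · apply Integrable.const_mul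
      refine (integrable_gauss ht).bdd_mul (c := (∫ x, ‖g x‖) ^ 2) (by fun_prop) (Filter.Eventually.of_forall fun x => ?_)
      rw [norm_pow, norm_norm]
      gcongr
      exact norm_fourier_le g x
    · exact Filter.Eventually.of_forall fun x => by simp only [Pi.zero_apply]; positivity
  rw [setLIntegral_congr_fun measurableSet_Ioi h1, lintegral_lintegral_swap]
  · refine lintegral_congr_ae ?_
    filter_upwards [ae_ne hd 0] with ξ hξ
    have hn : 0 < ‖ξ‖ := by simpa using hξ
    rw [lintegral_const_mul _ (by fun_prop), t_int1 ha (by positivity), const_split hn,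
      ENNReal.ofReal_mul (p := (1 / Real.pi) ^ a * Real.Gamma a)
        (by have := Real.Gamma_pos_of_pos ha; positivity)]
    exact mul_left_comm _ _ _
  · apply Measurable.aemeasurable
    simp only [Function.uncurry_def]
    fun_prop

lemma energy_identity (hd : 1 ≤ d) {g : EE d → ℂ} (hg : Integrable g) {a b : ℝ} (ha : 0 < a)
    (hb : 0 < b) (hab : a + b = d / 2)
    (hA : ∫⁻ x, ∫⁻ y, ‖g x‖ₑ * (‖g y‖ₑ * ENNReal.ofReal (‖x - y‖ ^ (-(2 * b)))) < ∞) :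
    ENNReal.ofReal ((1 / Real.pi) ^ a * Real.Gamma a) *
      ∫⁻ ξ, ‖𝓕 g ξ‖ₑ ^ 2 * ENNReal.ofReal (‖ξ‖ ^ (-(2 * a))) =
    ENNReal.ofReal ((((1 / Real.pi) ^ b * Real.Gamma b : ℝ) : ℂ) *
      ∫ x, g x * ∫ y, star (g y) * ((‖x - y‖ ^ (-(2 * b)) : ℝ) : ℂ)).re := by
  rw [energy_left hd hg ha]
  set τ := (volume : Measure ℝ).restrict (Set.Ioi 0) with hτ
  set c2 := (1 / Real.pi) ^ b * Real.Gamma b with hc2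
  have hc2p : 0 < c2 := by have := Real.Gamma_pos_of_pos hb; positivity
  set K : ℝ → EE d → EE d → ℝ := fun t x y =>
    t ^ (-b - 1) * Real.exp (-(Real.pi * ‖x - y‖ ^ 2 / t)) with hK
  have hKm : Measurable (fun p : ℝ × (EE d × EE d) => K p.1 p.2.1 p.2.2) := by
    simp only [hK]; fun_prop
  set H : ℝ × (EE d × EE d) → ℂ := fun p => g p.2.1 * star (g p.2.2) * (K p.1 p.2.1 p.2.2 : ℂ) with hH
  have hgm := hg.aestronglyMeasurable
  have hHm : AEStronglyMeasurable H (τ.prod (volume.prod volume)) := by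
    refine ((AEStronglyMeasurable.comp_snd (hgm.comp_fst)).mul
      (AEStronglyMeasurable.comp_snd ((int_star hg).aestronglyMeasurable.comp_snd))).mul ?_
    exact (Complex.measurable_ofReal.comp hKm).aestronglyMeasurable
  have hgp : AEMeasurable (fun p : EE d × EE d => ‖g p.1‖ₑ * (‖g p.2‖ₑ * ENNReal.ofReal (‖p.1 - p.2‖ ^ (-(2 * b)))))
      (volume.prod volume) := by
    refine hgm.comp_fst.enorm.mul (hgm.comp_snd.enorm.mul ?_)
    fun_prop
  have hHi : Integrable H (τ.prod (volume.prod volume)) := by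
    refine ⟨hHm, ?_⟩
    rw [HasFiniteIntegral, lintegral_prod_symm _ hHm.enorm]
    have : ∫⁻ p : EE d × EE d, ∫⁻ t, ‖H (t, p)‖ₑ ∂τ ∂(volume.prod volume) =
        ∫⁻ p : EE d × EE d, ENNReal.ofReal c2 * (‖g p.1‖ₑ * (‖g p.2‖ₑ * ENNReal.ofReal (‖p.1 - p.2‖ ^ (-(2 * b)))))
          ∂(volume.prod volume) := by
      refine lintegral_congr_ae ?_
      filter_upwards [ae_prod_ne hd] with p hp
      have hn : 0 < ‖p.1 - p.2‖ := by simpa [sub_eq_zero] using hp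
      have : ∀ t ∈ Set.Ioi (0:ℝ), ‖H (t, p)‖ₑ = ‖g p.1‖ₑ * ‖g p.2‖ₑ * ENNReal.ofReal (t ^ (-b - 1) * Real.exp (-(Real.pi * ‖p.1 - p.2‖ ^ 2 / t))) := by
        intro t ht
        have ht : (0:ℝ) < t := ht
        simp only [hH, hK]
        rw [enorm_mul, enorm_mul, enorm_star', ← ofReal_norm (((_ : ℝ)) : ℂ), Complex.norm_real, Real.norm_of_nonneg (by positivity)]
      rw [hτ, setLIntegral_congr_fun measurableSet_Ioi this, lintegral_const_mul _ (by fun_prop),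
        t_int2 hb (by positivity), const_split hn, ENNReal.ofReal_mul hc2p.le]
      ring
    rw [this, lintegral_const_mul'' _ hgp, lintegral_prod _ hgp]
    exact ENNReal.mul_lt_top ENNReal.ofReal_lt_top hA
  -- compute both iterated integrals
  set J : ℝ → ℝ := fun t => t ^ (a - 1) * ∫ ξ, ‖𝓕 g ξ‖ ^ 2 * Real.exp (-(Real.pi * ‖ξ‖ ^ 2 * t)) with hJ
  have hJH : ∀ᵐ t ∂τ, ∫ p, H (t, p) ∂(volume.prod volume) = (J t : ℂ) := by
    filter_upwards [hHi.prod_right_ae, ae_restrict_mem measurableSet_Ioi] with t hti ht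
    have ht : (0:ℝ) < t := ht
    rw [integral_prod _ hti]
    simp only [hJ]
    rw [Complex.ofReal_mul, gauss_parseval hg ht, ← integral_const_mul]
    congr 1
    ext x
    rw [mul_left_comm, ← integral_const_mul, ← integral_const_mul]
    congr 1
    ext y
    simp only [hH, hK]
    rw [show -b - 1 = (a - 1) + (-((d:ℝ)/2)) by linarith, Real.rpow_add ht]
    push_cast
    ring
  have hJi : Integrable (fun t => (J t : ℂ)) τ := hHi.integral_prod_left.congr hJH
  have hJi' : Integrable J τ := by simpa using hJi.re
  have hJ0 : 0 ≤ᵐ[τ] J := by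
    filter_upwards [ae_restrict_mem measurableSet_Ioi] with t ht
    have ht : (0:ℝ) < t := ht
    simp only [hJ, Pi.zero_apply]
    refine mul_nonneg (by positivity) (integral_nonneg fun ξ => by simp only [Pi.zero_apply]; positivity)
  rw [← ofReal_integral_eq_lintegral_ofReal hJi' hJ0]
  congr 1
  have e1 : ((∫ t, J t ∂τ : ℝ) : ℂ) = ∫ z, H z ∂(τ.prod (volume.prod volume)) := by
    rw [integral_prod _ hHi, ← integral_complex_ofReal]
    exact (integral_congr_ae hJH).symm
  have hL : ∀ᵐ p ∂(volume.prod volume : Measure (EE d × EE d)), ∫ t, H (t, p) ∂τ =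
      (c2 : ℂ) * (g p.1 * (star (g p.2) * ((‖p.1 - p.2‖ ^ (-(2 * b)) : ℝ) : ℂ))) := by
    filter_upwards [ae_prod_ne hd] with p hp
    have hn : 0 < ‖p.1 - p.2‖ := by simpa [sub_eq_zero] using hp
    simp only [hH, hK]
    rw [integral_const_mul, integral_complex_ofReal, hτ, t_int2' hb (by positivity), const_split hn, ← hc2,
      Complex.ofReal_mul]
    ring
  have e2 : ∫ z, H z ∂(τ.prod (volume.prod volume)) = (c2 : ℂ) *
      ∫ x, g x * ∫ y, star (g y) * ((‖x - y‖ ^ (-(2 * b)) : ℝ) : ℂ) := by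
    rw [integral_prod_symm _ hHi, integral_congr_ae hL, integral_prod _ (hHi.integral_prod_right.congr hL),
      ← integral_const_mul]
    congr 1
    ext x
    rw [← integral_const_mul, ← integral_const_mul]
  rw [← e2, ← e1, Complex.ofReal_re]


noncomputable def WW (μ : ℝ) (f : EE d → ℂ) (x : EE d) : ℂ :=
  (↑(‖x‖ ^ (-(2 * μ))) : ℂ) * f (sig x)

lemma measurable_WW (μ : ℝ) {f : EE d → ℂ} (hf : Measurable f) : Measurable (WW μ f) := by
  unfold WW
  exact (Complex.measurable_ofReal.comp (by fun_prop)).mul (hf.comp measurable_sig)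

lemma local_int (hd : 1 ≤ d) {β : ℝ} (hβ : β < d) :
    ∫⁻ x in Metric.ball (0 : EE d) 1, ENNReal.ofReal (‖x‖ ^ (-β)) < ∞ := by
  have : Nonempty (Fin d) := ⟨⟨0, hd⟩⟩
  have h : IntegrableOn (fun x : EE d => ‖x‖ ^ (-β)) (Metric.ball 0 1) := by
    rw [integrableOn_fun_norm_addHaar (f := fun r => r ^ (-β)) volume, finrank_euclideanSpace_fin]
    have h2 : IntegrableOn (fun y : ℝ => y ^ ((d:ℝ) - 1 - β)) (Set.Ioo 0 1) := by
      rw [intervalIntegral.integrableOn_Ioo_rpow_iff zero_lt_one]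
      linarith
    refine h2.congr_fun (fun y hy => ?_) measurableSet_Ioo
    have hy : 0 < y := hy.1
    simp only [smul_eq_mul]
    rw [← Real.rpow_natCast, ← Real.rpow_add hy, Nat.cast_sub hd]
    push_cast
    congr 1
  have h3 := h.2
  rw [HasFiniteIntegral] at h3
  refine lt_of_eq_of_lt ?_ h3
  congr 1
  ext x
  rw [← ofReal_norm, Real.norm_of_nonneg (by positivity)]

lemma potential_bound (hd : 1 ≤ d) {β : ℝ} (hβ0 : 0 < β) (hβ : β < d) {f : EE d → ℂ} (hf : Integrable f)
    {M : ℝ} (hM : ∀ x, ‖f x‖ ≤ M) :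
    ∃ C : ℝ≥0∞, C < ∞ ∧ ∀ x, ∫⁻ y, ‖f y‖ₑ * ENNReal.ofReal (‖x - y‖ ^ (-β)) ≤ C := by
  set k : EE d → ℝ≥0∞ := (Metric.ball (0 : EE d) 1).indicator (fun x => ENNReal.ofReal (‖x‖ ^ (-β))) with hk
  have hkm : Measurable k := by
    refine Measurable.indicator ?_ measurableSet_ball
    fun_prop
  refine ⟨ENNReal.ofReal M * (∫⁻ x, k x) + ∫⁻ y, ‖f y‖ₑ, ?_, fun x => ?_⟩
  · refine ENNReal.add_lt_top.2 ⟨ENNReal.mul_lt_top ENNReal.ofReal_lt_top ?_, hf.2⟩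
    rw [hk, lintegral_indicator measurableSet_ball]
    exact local_int hd hβ
  · calc ∫⁻ y, ‖f y‖ₑ * ENNReal.ofReal (‖x - y‖ ^ (-β))
        ≤ ∫⁻ y, (ENNReal.ofReal M * k (x - y) + ‖f y‖ₑ) := by
          refine lintegral_mono fun y => ?_
          by_cases h : x - y ∈ Metric.ball (0 : EE d) 1
          · simp only [hk, Set.indicator_of_mem h]
            refine le_add_right ?_
            gcongr
            rw [← ofReal_norm]
            exact ENNReal.ofReal_le_ofReal (hM y)
          · simp only [hk, Set.indicator_of_notMem h]
            rw [mul_zero, zero_add]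
            refine mul_le_of_le_one_right' ?_
            rw [← ENNReal.ofReal_one]
            refine ENNReal.ofReal_le_ofReal ?_
            apply Real.rpow_le_one_of_one_le_of_nonpos
            · simpa using h
            · linarith
      _ = _ := by
          rw [lintegral_add_left (by fun_prop), lintegral_const_mul _ (by fun_prop), 
            lintegral_sub_left_eq_self k x]

lemma W_weight {μ : ℝ} {x : EE d} (hx : x ≠ 0) : ‖x‖ ^ (-(2 * μ)) =
    ‖x‖ ^ (-(2 * (d:ℝ))) * ‖sig x‖ ^ (-(2 * (d - μ))) := by
  have hn : 0 < ‖x‖ := by simpa using hx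
  rw [norm_sig, Real.inv_rpow hn.le, ← Real.rpow_neg hn.le, ← Real.rpow_add hn]
  congr 1
  ring

lemma W_weight2 {μ : ℝ} {x y : EE d} (hx : x ≠ 0) (hy : y ≠ 0) : 
    ‖x‖ ^ (-(2 * μ)) * ‖y‖ ^ (-(2 * μ)) * ‖x - y‖ ^ (-(2 * (d - μ))) =
    ‖x‖ ^ (-(2 * (d:ℝ))) * ‖y‖ ^ (-(2 * (d:ℝ))) * ‖sig x - sig y‖ ^ (-(2 * (d - μ))) := by
  have hn : 0 < ‖x‖ := by simpa using hx
  have hn2 : 0 < ‖y‖ := by simpa using hy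
  rw [norm_sig_sub hx hy, Real.mul_rpow (by positivity) (by positivity),
    Real.mul_rpow (by positivity) (by positivity), W_weight hx, W_weight hy, norm_sig, norm_sig]
  ring

lemma integrable_WW (hd : 1 ≤ d) {μ : ℝ} (h1 : (d:ℝ) / 2 < μ) (h2 : μ < d) {f : EE d → ℂ}
    (hf : Integrable f) (hfm : Measurable f) {M : ℝ} (hM : ∀ x, ‖f x‖ ≤ M) :
    Integrable (WW μ f) := by
  refine ⟨(measurable_WW μ hfm).aestronglyMeasurable, ?_⟩
  obtain ⟨C, hC, hb⟩ := potential_bound hd (β := 2 * (d - μ)) (by linarith) (by linarith) hf hM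
  refine lt_of_le_of_lt ?_ ((hb 0).trans_lt hC)
  rw [← lintegral_sig hd (fun y => ‖f y‖ₑ * ENNReal.ofReal (‖0 - y‖ ^ (-(2 * (d - μ)))))]
  refine lintegral_mono_ae ?_
  filter_upwards [ae_ne hd 0] with x hx
  rw [WW, enorm_mul, ← ofReal_norm (((_ : ℝ)) : ℂ), Complex.norm_real, Real.norm_of_nonneg (by positivity),
    W_weight hx, ENNReal.ofReal_mul (by positivity), zero_sub, norm_neg]
  apply le_of_eq
  ring

lemma WW_energy_abs (hd : 1 ≤ d) (μ : ℝ) (f : EE d → ℂ) :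
    ∫⁻ x, ∫⁻ y, ‖WW μ f x‖ₑ * (‖WW μ f y‖ₑ * ENNReal.ofReal (‖x - y‖ ^ (-(2 * (d - μ))))) =
    ∫⁻ x, ∫⁻ y, ‖f x‖ₑ * (‖f y‖ₑ * ENNReal.ofReal (‖x - y‖ ^ (-(2 * (d - μ))))) := by
  rw [← lintegral_sig hd (fun x => ∫⁻ y, ‖f x‖ₑ * (‖f y‖ₑ * ENNReal.ofReal (‖x - y‖ ^ (-(2 * (d - μ))))))]
  refine lintegral_congr_ae ?_
  filter_upwards [ae_ne hd 0] with x hx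
  rw [← lintegral_sig hd (fun y => ‖f (sig x)‖ₑ * (‖f y‖ₑ * ENNReal.ofReal (‖sig x - y‖ ^ (-(2 * (d - μ)))))),
    ← lintegral_const_mul' _ _ ENNReal.ofReal_ne_top]
  refine lintegral_congr_ae ?_
  filter_upwards [ae_ne hd 0] with y hy
  have h := congrArg ENNReal.ofReal (W_weight2 (μ := μ) hx hy)
  rw [ENNReal.ofReal_mul (by positivity), ENNReal.ofReal_mul (by positivity),
    ENNReal.ofReal_mul (by positivity), ENNReal.ofReal_mul (by positivity)] at h
  rw [WW, WW, enorm_mul, enorm_mul, ← ofReal_norm (((_ : ℝ)) : ℂ), Complex.norm_real, Real.norm_of_nonneg (by positivity),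
    ← ofReal_norm (((_ : ℝ)) : ℂ), Complex.norm_real, Real.norm_of_nonneg (by positivity)]
  refine (?_ : _ = _).trans ((congrArg (fun z => ‖f (sig x)‖ₑ * ‖f (sig y)‖ₑ * z) h).trans ?_)
  · ring
  · ring

lemma WW_energy (hd : 1 ≤ d) (μ : ℝ) (f : EE d → ℂ) :
    ∫ x, WW μ f x * ∫ y, star (WW μ f y) * ((‖x - y‖ ^ (-(2 * (d - μ))) : ℝ) : ℂ) =
    ∫ x, f x * ∫ y, star (f y) * ((‖x - y‖ ^ (-(2 * (d - μ))) : ℝ) : ℂ) := by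
  rw [← integral_sig hd (fun x => f x * ∫ y, star (f y) * ((‖x - y‖ ^ (-(2 * (d - μ))) : ℝ) : ℂ))]
  refine integral_congr_ae ?_
  filter_upwards [ae_ne hd 0] with x hx
  rw [← integral_sig hd (fun y => star (f y) * ((‖sig x - y‖ ^ (-(2 * (d - μ))) : ℝ) : ℂ)),
    ← integral_const_mul, ← integral_const_mul, ← integral_const_mul]
  refine integral_congr_ae ?_
  filter_upwards [ae_ne hd 0] with y hy
  have h := congrArg Complex.ofReal (W_weight2 (μ := μ) hx hy)
  simp only [WW, Complex.star_def, map_mul, Complex.conj_ofReal]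
  simp only [Complex.ofReal_mul] at h
  linear_combination (f (sig x) * (starRingEnd ℂ) (f (sig y))) * h

lemma energy_abs_finite (hd : 1 ≤ d) {β : ℝ} (hβ0 : 0 < β) (hβ : β < d) {f : EE d → ℂ} (hf : Integrable f)
    {M : ℝ} (hM : ∀ x, ‖f x‖ ≤ M) :
    ∫⁻ x, ∫⁻ y, ‖f x‖ₑ * (‖f y‖ₑ * ENNReal.ofReal (‖x - y‖ ^ (-β))) < ∞ := by
  obtain ⟨C, hC, hb⟩ := potential_bound hd hβ0 hβ hf hM
  calc _ ≤ ∫⁻ x, ‖f x‖ₑ * C := by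
        refine lintegral_mono fun x => ?_
        rw [lintegral_const_mul' _ _ (by simp)]
        gcongr
        exact hb x
    _ < ∞ := by
        rw [lintegral_mul_const' _ _ hC.ne]
        exact ENNReal.mul_lt_top hf.2 hC

/-- The isometry property for `d/2 < μ < d`. -/
theorem weyl_isometry_neg (hd : 1 ≤ d) {μ : ℝ} (h1 : (d:ℝ) / 2 < μ) (h2 : μ < d) {f : EE d → ℂ}
    (hf : Integrable f) (hfm : Measurable f) {M : ℝ} (hM : ∀ x, ‖f x‖ ≤ M) :
    ∫⁻ ξ, ‖𝓕 (WW μ f) ξ‖ₑ ^ 2 * ENNReal.ofReal (‖ξ‖ ^ ((d:ℝ) - 2 * μ)) =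
    ∫⁻ ξ, ‖𝓕 f ξ‖ₑ ^ 2 * ENNReal.ofReal (‖ξ‖ ^ ((d:ℝ) - 2 * μ)) := by
  have hW := integrable_WW hd h1 h2 hf hfm hM
  have hA := energy_abs_finite hd (β := 2 * (d - μ)) (by linarith) (by linarith) hf hM
  have hA' := (WW_energy_abs hd μ f).trans_lt hA
  have ha : 0 < μ - d / 2 := by linarith
  have e1 := energy_identity hd hf ha (b := d - μ) (by linarith) (by ring) hA
  have e2 := energy_identity hd hW ha (b := d - μ) (by linarith) (by ring) hA'
  rw [WW_energy hd, ← e1] at e2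
  rw [show (d:ℝ) - 2 * μ = -(2 * (μ - d / 2)) by ring]
  have hG := Real.Gamma_pos_of_pos ha
  refine (ENNReal.mul_right_inj ?_ ENNReal.ofReal_ne_top).1 e2
  rw [ne_eq, ENNReal.ofReal_eq_zero, not_le]
  positivity


lemma fourierInv_bdd (h : EE d → ℂ) (x : EE d) : ‖𝓕⁻ h x‖ ≤ ∫ y, ‖h y‖ := by
  rw [Real.fourierInv_eq_fourier_neg]; exact norm_fourier_le _ _

lemma lintegral_CS {u v : EE d → ℝ≥0∞} (hu : AEMeasurable u) (hv : AEMeasurable v) :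
    ∫⁻ x, u x * v x ≤ (∫⁻ x, u x ^ 2) ^ (1/2 : ℝ) * (∫⁻ x, v x ^ 2) ^ (1/2 : ℝ) := by
  have := ENNReal.lintegral_mul_le_Lp_mul_Lq volume Real.HolderConjugate.two_two hu hv
  simpa using this

/-- the duality core -/
lemma dual_core {g : EE d → ℂ} (hg : Integrable g) {s : ℝ} (hd : 1 ≤ d) (B : ℝ≥0∞)
    (hdual : ∀ φ : EE d → ℂ, Continuous φ → Integrable φ → Integrable (𝓕 φ) →
      ‖∫ x, g x * φ x‖ₑ ≤ B ^ (1/2 : ℝ) *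
        (∫⁻ ξ, ‖𝓕 φ ξ‖ₑ ^ 2 * ENNReal.ofReal (‖ξ‖ ^ (-s))) ^ (1/2 : ℝ))
    (mr : EE d → ℝ) (h0 : ∀ ξ, 0 ≤ mr ξ) (h1 : ∀ ξ, mr ξ ≤ ‖ξ‖ ^ s)
    (m : SchwartzMap (EE d) ℂ) (hm : ∀ ξ, m ξ = (mr ξ : ℂ)) :
    ∫⁻ ξ, ‖𝓕 g ξ‖ₑ ^ 2 * ENNReal.ofReal (mr ξ) ≤ B := by
  set K : SchwartzMap (EE d) ℂ := 𝓕⁻ m with hK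
  set P : EE d → ℂ := convolution (K : EE d → ℂ) g (ContinuousLinearMap.mul ℂ ℂ) volume with hP
  have hPi : Integrable P := K.integrable.integrable_convolution _ hg
  have hPc : Continuous P := by
    refine BddAbove.continuous_convolution_left_of_integrable _ ?_ K.continuous hg
    refine ⟨∫ y, ‖m y‖, ?_⟩
    rintro _ ⟨x, rfl⟩
    simp only [hK, SchwartzMap.fourierInv_coe]
    exact fourierInv_bdd _ x
  have hFK : 𝓕 (K : EE d → ℂ) = m := by
    rw [← SchwartzMap.fourier_coe, hK, FourierTransform.fourier_fourierInv_eq]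
  have hFP : 𝓕 P = fun ξ => 𝓕 g ξ * m ξ := by
    ext ξ
    rw [hP, Real.fourier_mul_convolution_eq K.integrable hg, hFK, mul_comm]
  have hFPi : Integrable (𝓕 P) := by
    rw [hFP]
    exact bdd_mul_int (continuous_fourier hg) _ (norm_fourier_le g) m.integrable
  have hinv := hPc.fourierInv_fourier_eq hPi hFPi
  have hφ : (fun x => star (P x)) = 𝓕 (fun ξ => star (𝓕 P ξ)) := by
    ext x
    rw [fourier_star, ← Real.fourierInv_eq_fourier_neg, hinv]
  have hFφ : 𝓕 (fun x => star (P x)) = fun ξ => star (𝓕 P (-ξ)) := by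
    ext ξ; rw [fourier_star]
  have key := hdual (fun x => star (P x)) hPc.star (int_star hPi) (by
    rw [hFφ]; exact int_star hFPi.comp_neg)
  -- the pairing
  have hmr : Integrable (fun ξ => ‖𝓕 g ξ‖ ^ 2 * mr ξ) := by
    have h := bdd_mul_int (continuous_fourier hg).star _ (fun x => by rw [norm_star]; exact norm_fourier_le g x) hFPi
    refine h.re.congr (Filter.Eventually.of_forall fun ξ => ?_)
    simp only [hFP, hm]
    rw [← mul_assoc, Complex.star_def, Complex.conj_mul']
    norm_cast
  have hpair : ∫ x, g x * star (P x) = ((∫ ξ, ‖𝓕 g ξ‖ ^ 2 * mr ξ : ℝ) : ℂ) := by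
    have e : ∀ x, star (P x) = 𝓕 (fun ξ => star (𝓕 P ξ)) x := fun x => congrFun hφ x
    simp_rw [e]
    rw [← fourier_flip hg (int_star hFPi), ← integral_complex_ofReal]
    congr 1
    ext ξ
    simp only [hFP, hm, star_mul', Complex.star_def, Complex.conj_ofReal]
    rw [← mul_assoc, Complex.mul_conj']
    push_cast; rfl
  set X := ∫⁻ ξ, ‖𝓕 g ξ‖ₑ ^ 2 * ENNReal.ofReal (mr ξ) with hX
  have hXe : ‖∫ x, g x * star (P x)‖ₑ = X := by
    have hnn : ∀ ξ, 0 ≤ ‖𝓕 g ξ‖ ^ 2 * mr ξ := fun ξ => mul_nonneg (by positivity) (h0 ξ)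
    rw [hpair, ← ofReal_norm, Complex.norm_real, Real.norm_of_nonneg (integral_nonneg hnn),
      ofReal_integral_eq_lintegral_ofReal hmr (Filter.Eventually.of_forall hnn), hX]
    congr 1
    ext ξ
    rw [ENNReal.ofReal_mul (by positivity), ENNReal.ofReal_pow (norm_nonneg _), ofReal_norm]
  have hXfin : X ≠ ⊤ := by rw [← hXe]; exact enorm_ne_top
  have hN : ∫⁻ ξ, ‖𝓕 (fun x => star (P x)) ξ‖ₑ ^ 2 * ENNReal.ofReal (‖ξ‖ ^ (-s)) ≤ X := by
    rw [hFφ, hX, ← lintegral_neg_eq_self]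
    refine lintegral_mono_ae ?_
    filter_upwards [ae_ne hd 0] with ξ hξ
    have hn : 0 < ‖ξ‖ := by simpa using hξ
    rw [neg_neg, norm_neg, enorm_star', hFP]
    simp only
    rw [enorm_mul, hm, mul_pow, mul_assoc]
    gcongr
    rw [← ofReal_norm (((_ : ℝ)) : ℂ), Complex.norm_real, Real.norm_of_nonneg (h0 ξ), ← ENNReal.ofReal_pow (h0 ξ),
      ← ENNReal.ofReal_mul (by have := h0 ξ; positivity)]
    refine ENNReal.ofReal_le_ofReal ?_
    rw [Real.rpow_neg hn.le, ← div_eq_mul_inv, div_le_iff₀ (by positivity), sq]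
    exact mul_le_mul_of_nonneg_left (h1 ξ) (h0 ξ)
  rw [hXe] at key
  have key2 : X ≤ B ^ (1/2 : ℝ) * X ^ (1/2 : ℝ) := key.trans (by gcongr)
  by_cases hX0 : X = 0
  · rw [hX0]; exact zero_le
  have hXh : X = X ^ (1/2 : ℝ) * X ^ (1/2 : ℝ) := by
    rw [← ENNReal.rpow_add _ _ hX0 hXfin]; norm_num
  have hXh0 : X ^ (1/2 : ℝ) ≠ 0 := by simp [hX0]
  have hXhf : X ^ (1/2 : ℝ) ≠ ⊤ := by simp [hXfin]
  have key3 : X ^ (1/2 : ℝ) ≤ B ^ (1/2 : ℝ) := by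
    conv_lhs at key2 => rw [hXh]
    exact (ENNReal.mul_le_mul_iff_left hXh0 hXhf).1 key2
  exact (ENNReal.rpow_le_rpow_iff (by norm_num)).1 key3

noncomputable def cut (k s r : ℝ) : ℝ :=
  r ^ s * (Real.smoothTransition (k * r - 1) * (1 - Real.smoothTransition (r / k - 1)))

lemma cut_contDiff {k : ℝ} (hk : 0 < k) (s : ℝ) : ContDiff ℝ ((⊤ : ℕ∞) : WithTop ℕ∞) (cut k s) := by
  rw [contDiff_iff_contDiffAt]
  intro r
  by_cases hr : r < 1 / k
  · have : cut k s =ᶠ[nhds r] fun _ => 0 := by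
      filter_upwards [gt_mem_nhds hr] with y hy
      rw [lt_div_iff₀ hk] at hy
      rw [cut, Real.smoothTransition.zero_of_nonpos (by linarith)]
      ring
    exact contDiffAt_const.congr_of_eventuallyEq this
  · have hr0 : r ≠ 0 := by
      have : 0 < 1 / k := by positivity
      intro h; rw [h] at hr; exact hr this
    unfold cut
    refine (Real.contDiffAt_rpow_const_of_ne hr0).mul (ContDiffAt.mul ?_ ?_)
    · exact (Real.smoothTransition.contDiff.comp (by fun_prop)).contDiffAt
    · exact contDiffAt_const.sub (Real.smoothTransition.contDiff.comp (by fun_prop)).contDiffAt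

lemma exists_mult {k : ℝ} (hk : 0 < k) (s : ℝ) :
    ∃ m : SchwartzMap (EE d) ℂ, ∀ ξ, m ξ = ((cut k (s / 2) (‖ξ‖ ^ 2) : ℝ) : ℂ) := by
  have hc : ContDiff ℝ ((⊤ : ℕ∞) : WithTop ℕ∞) (fun ξ : EE d => ((cut k (s / 2) (‖ξ‖ ^ 2) : ℝ) : ℂ)) :=
    Complex.ofRealCLM.contDiff.comp ((cut_contDiff hk _).comp (contDiff_norm_sq ℝ))
  have hs : HasCompactSupport (fun ξ : EE d => ((cut k (s / 2) (‖ξ‖ ^ 2) : ℝ) : ℂ)) := by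
    refine HasCompactSupport.of_support_subset_isCompact (isCompact_closedBall (0 : EE d) (Real.sqrt (2 * k))) ?_
    intro ξ hξ
    by_contra hn
    apply hξ
    simp only [Metric.mem_closedBall, dist_zero_right, not_le] at hn
    have : 2 * k < ‖ξ‖ ^ 2 := by
      rwa [Real.sqrt_lt' (lt_of_le_of_lt (Real.sqrt_nonneg _) hn)] at hn
    show ((cut k (s / 2) (‖ξ‖ ^ 2) : ℝ) : ℂ) = 0
    rw [cut, Real.smoothTransition.one_of_one_le (x := ‖ξ‖ ^ 2 / k - 1)]
    · simp
    · rw [le_sub_iff_add_le, le_div_iff₀ hk]; linarith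
  exact ⟨hs.toSchwartzMap hc, fun ξ => rfl⟩

lemma norm_sq_rpow (ξ : EE d) (s : ℝ) : (‖ξ‖ ^ 2) ^ (s / 2) = ‖ξ‖ ^ s := by
  rw [← Real.rpow_natCast, ← Real.rpow_mul (norm_nonneg _)]
  congr 1
  push_cast; ring

/-- Dual bound gives the full norm bound. -/
lemma dual_full {g : EE d → ℂ} (hg : Integrable g) {s : ℝ} (hd : 1 ≤ d) (B : ℝ≥0∞)
    (hdual : ∀ φ : EE d → ℂ, Continuous φ → Integrable φ → Integrable (𝓕 φ) →
      ‖∫ x, g x * φ x‖ₑ ≤ B ^ (1/2 : ℝ) *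
        (∫⁻ ξ, ‖𝓕 φ ξ‖ₑ ^ 2 * ENNReal.ofReal (‖ξ‖ ^ (-s))) ^ (1/2 : ℝ)) :
    ∫⁻ ξ, ‖𝓕 g ξ‖ₑ ^ 2 * ENNReal.ofReal (‖ξ‖ ^ s) ≤ B := by
  set F : ℕ → EE d → ℝ≥0∞ := fun n ξ =>
    ‖𝓕 g ξ‖ₑ ^ 2 * ENNReal.ofReal (cut ((n:ℝ) + 1) (s / 2) (‖ξ‖ ^ 2)) with hF
  have hFB : ∀ n, ∫⁻ ξ, F n ξ ≤ B := by
    intro n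
    have hk : (0:ℝ) < n + 1 := by positivity
    obtain ⟨m, hm⟩ := exists_mult (d := d) hk s
    refine dual_core hg hd B hdual _ (fun ξ => ?_) (fun ξ => ?_) m hm
    · have := Real.smoothTransition.nonneg (((n:ℝ) + 1) * ‖ξ‖ ^ 2 - 1)
      have := Real.smoothTransition.le_one (‖ξ‖ ^ 2 / ((n:ℝ) + 1) - 1)
      rw [cut]
      exact mul_nonneg (by positivity) (mul_nonneg (by assumption) (by linarith))
    · have a1 := Real.smoothTransition.nonneg (((n:ℝ) + 1) * ‖ξ‖ ^ 2 - 1)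
      have a2 := Real.smoothTransition.le_one (((n:ℝ) + 1) * ‖ξ‖ ^ 2 - 1)
      have b1 := Real.smoothTransition.nonneg (‖ξ‖ ^ 2 / ((n:ℝ) + 1) - 1)
      have b2 := Real.smoothTransition.le_one (‖ξ‖ ^ 2 / ((n:ℝ) + 1) - 1)
      rw [cut, norm_sq_rpow]
      exact mul_le_of_le_one_right (by positivity) (mul_le_one₀ a2 (by linarith) (by linarith))
  have hFm : ∀ n, Measurable (F n) := by
    intro n
    have h1 : Measurable (𝓕 g) := (continuous_fourier hg).measurable
    have h2 : Measurable (cut ((n:ℝ) + 1) (s / 2)) :=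
      (cut_contDiff (by positivity) _).continuous.measurable
    simp only [hF]
    fun_prop
  have hlim : ∀ᵐ ξ : EE d, ‖𝓕 g ξ‖ₑ ^ 2 * ENNReal.ofReal (‖ξ‖ ^ s) ≤ Filter.liminf (fun n => F n ξ) Filter.atTop := by
    filter_upwards [ae_ne hd 0] with ξ hξ
    have hn : 0 < ‖ξ‖ := by simpa using hξ
    obtain ⟨N, hN⟩ := exists_nat_ge (max (2 / ‖ξ‖ ^ 2) (‖ξ‖ ^ 2))
    refine Filter.le_liminf_of_le (by isBoundedDefault) ?_
    filter_upwards [Filter.eventually_ge_atTop N] with n hnN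
    have hnN' : (N:ℝ) ≤ n := by exact_mod_cast hnN
    have c1 : 2 / ‖ξ‖ ^ 2 ≤ (n:ℝ) + 1 := by linarith [le_max_left (2 / ‖ξ‖ ^ 2) (‖ξ‖ ^ 2)]
    have c2 : ‖ξ‖ ^ 2 ≤ (n:ℝ) + 1 := by linarith [le_max_right (2 / ‖ξ‖ ^ 2) (‖ξ‖ ^ 2)]
    rw [div_le_iff₀ (by positivity)] at c1
    simp only [hF]
    rw [cut, norm_sq_rpow, Real.smoothTransition.one_of_one_le (by linarith),
      Real.smoothTransition.zero_of_nonpos]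
    · simp
    · rw [sub_nonpos, div_le_one (by positivity)]; exact c2
  calc _ ≤ ∫⁻ ξ, Filter.liminf (fun n => F n ξ) Filter.atTop := lintegral_mono_ae hlim
    _ ≤ Filter.liminf (fun n => ∫⁻ ξ, F n ξ) Filter.atTop := lintegral_liminf_le hFm
    _ ≤ B := Filter.liminf_le_of_le (by isBoundedDefault) (fun b hb => by
        obtain ⟨n, hn⟩ := hb.exists
        exact hn.trans (hFB n))


lemma bdd_of_inv {φ : EE d → ℂ} (hc : Continuous φ) (hi : Integrable φ) (hFi : Integrable (𝓕 φ))
    (x : EE d) : ‖φ x‖ ≤ ∫ y, ‖𝓕 φ y‖ := by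
  have := hc.fourierInv_fourier_eq hi hFi
  conv_lhs => rw [← this]
  exact fourierInv_bdd _ _

lemma schwartz_fourier_int (f : SchwartzMap (EE d) ℂ) : Integrable (𝓕 (f : EE d → ℂ)) := by
  rw [← SchwartzMap.fourier_coe]; exact (𝓕 f).integrable

lemma dual_pos (hd : 1 ≤ d) {μ : ℝ} (h1 : 0 < μ) (h2 : μ < d / 2) (f : SchwartzMap (EE d) ℂ)
    (φ : EE d → ℂ) (hc : Continuous φ) (hi : Integrable φ) (hFi : Integrable (𝓕 φ)) :
    ‖∫ x, WW μ f x * φ x‖ₑ ≤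
      (∫⁻ ξ, ‖𝓕 (f : EE d → ℂ) ξ‖ₑ ^ 2 * ENNReal.ofReal (‖ξ‖ ^ ((d:ℝ) - 2 * μ))) ^ (1/2 : ℝ) *
        (∫⁻ ξ, ‖𝓕 φ ξ‖ₑ ^ 2 * ENNReal.ofReal (‖ξ‖ ^ (-((d:ℝ) - 2 * μ)))) ^ (1/2 : ℝ) := by
  have hb := bdd_of_inv hc hi hFi
  have hv : Integrable (WW (d - μ) φ) :=
    integrable_WW hd (by linarith) (by linarith) hi hc.measurable hb
  have hiso := weyl_isometry_neg (μ := d - μ) hd (by linarith) (by linarith) hi hc.measurable hb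
  have hs : (d:ℝ) - 2 * (d - μ) = -((d:ℝ) - 2 * μ) := by ring
  rw [hs] at hiso
  have e1 : ∫ x, WW μ f x * φ x = ∫ x, f x * WW (d - μ) φ x := by
    rw [← integral_sig hd (fun x => f x * WW (d - μ) φ x)]
    refine integral_congr_ae ?_
    filter_upwards [ae_ne hd 0] with x hx
    simp only [WW]
    rw [W_weight hx, sig_sig x]
    push_cast
    ring
  have e2 : (f : EE d → ℂ) = 𝓕 (𝓕⁻ (f : EE d → ℂ)) := by
    rw [← SchwartzMap.fourierInv_coe, ← SchwartzMap.fourier_coe,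
      FourierTransform.fourier_fourierInv_eq]
  have hIi : Integrable (𝓕⁻ (f : EE d → ℂ)) := by
    rw [← SchwartzMap.fourierInv_coe]; exact (𝓕⁻ f).integrable
  have hIc : Continuous (𝓕⁻ (f : EE d → ℂ)) := by
    rw [← SchwartzMap.fourierInv_coe]; exact (𝓕⁻ f).continuous
  have e3 : ∫ x, f x * WW (d - μ) φ x = ∫ ξ, 𝓕⁻ (f : EE d → ℂ) ξ * 𝓕 (WW (d - μ) φ) ξ := by
    rw [← fourier_flip hIi hv, ← e2]
  rw [e1, e3, ← hiso]
  have hpow : ∀ (r a : ℝ), 0 ≤ r → ENNReal.ofReal (r ^ (a / 2)) ^ 2 = ENNReal.ofReal (r ^ a) := by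
    intro r a hr
    rw [← ENNReal.ofReal_pow (by positivity), ← Real.rpow_natCast, ← Real.rpow_mul hr]
    congr 2; push_cast; ring
  set s := (d:ℝ) - 2 * μ with hsd
  have hFm : Measurable (𝓕 (WW (d - μ) φ)) := (continuous_fourier hv).measurable
  have hIm := hIc.measurable
  have hB : ∫⁻ ξ, ‖𝓕 (f : EE d → ℂ) ξ‖ₑ ^ 2 * ENNReal.ofReal (‖ξ‖ ^ s) =
      ∫⁻ ξ, ‖𝓕⁻ (f : EE d → ℂ) ξ‖ₑ ^ 2 * ENNReal.ofReal (‖ξ‖ ^ s) := by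
    rw [← lintegral_neg_eq_self]
    refine lintegral_congr fun ξ => ?_
    rw [Real.fourierInv_eq_fourier_neg, norm_neg]
  calc _ ≤ ∫⁻ ξ, ‖𝓕⁻ (f : EE d → ℂ) ξ * 𝓕 (WW (d - μ) φ) ξ‖ₑ := enorm_integral_le_lintegral_enorm _
    _ = ∫⁻ ξ, (‖𝓕⁻ (f : EE d → ℂ) ξ‖ₑ * ENNReal.ofReal (‖ξ‖ ^ (s / 2))) *
          (‖𝓕 (WW (d - μ) φ) ξ‖ₑ * ENNReal.ofReal (‖ξ‖ ^ (-s / 2))) := by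
        refine lintegral_congr_ae ?_
        filter_upwards [ae_ne hd 0] with ξ hξ
        have hn : 0 < ‖ξ‖ := by simpa using hξ
        have h : ENNReal.ofReal (‖ξ‖ ^ (s / 2)) * ENNReal.ofReal (‖ξ‖ ^ (-s / 2)) = 1 := by
          rw [← ENNReal.ofReal_mul (by positivity), ← Real.rpow_add hn]
          have : s / 2 + -s / 2 = 0 := by ring
          rw [this]; simp
        rw [enorm_mul, mul_mul_mul_comm, h, mul_one]
    _ ≤ _ := lintegral_CS (by fun_prop) (by fun_prop)
    _ = _ := by
        rw [hB]
        simp_rw [mul_pow, hpow _ _ (norm_nonneg _)]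

lemma plancherel_nice {φ : EE d → ℂ} (hc : Continuous φ) (hi : Integrable φ)
    (hFi : Integrable (𝓕 φ)) : ∫⁻ x, ‖φ x‖ₑ ^ 2 = ∫⁻ ξ, ‖𝓕 φ ξ‖ₑ ^ 2 := by
  have hinv := hc.fourierInv_fourier_eq hi hFi
  have hφ : ∀ x, star (φ x) = 𝓕 (fun ξ => star (𝓕 φ ξ)) x := by
    intro x
    rw [fourier_star, ← Real.fourierInv_eq_fourier_neg, hinv]
  have flip := fourier_flip hi (int_star hFi)
  simp_rw [← hφ] at flip
  have sqint : ∀ u : EE d → ℂ, Continuous u → Integrable u → (∃ M, ∀ x, ‖u x‖ ≤ M) →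
      ∫⁻ x, ‖u x‖ₑ ^ 2 = ENNReal.ofReal (∫ x, ‖u x‖ ^ 2) := by
    rintro u huc hui ⟨M, hM⟩
    have h : Integrable (fun x => ‖u x‖ ^ 2) := by
      refine ((bdd_mul_int huc M hM hui).norm).congr (Filter.Eventually.of_forall fun x => ?_)
      simp only [norm_mul, sq]
    rw [ofReal_integral_eq_lintegral_ofReal h (Filter.Eventually.of_forall fun x => by positivity)]
    refine lintegral_congr fun x => ?_
    rw [ENNReal.ofReal_pow (norm_nonneg _), ofReal_norm]
  have cplx : ∀ u : EE d → ℂ, ∫ x, u x * star (u x) = ((∫ x, ‖u x‖ ^ 2 : ℝ) : ℂ) := by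
    intro u
    rw [← integral_complex_ofReal]
    congr 1; ext x
    rw [Complex.star_def, Complex.mul_conj']; push_cast; rfl
  rw [cplx, cplx] at flip
  rw [sqint φ hc hi ⟨_, bdd_of_inv hc hi hFi⟩,
    sqint _ (continuous_fourier hi) hFi ⟨_, norm_fourier_le φ⟩]
  congr 1
  exact_mod_cast flip.symm

lemma dual_zero (hd : 1 ≤ d) {μ : ℝ} (h2 : μ = d / 2) (f : SchwartzMap (EE d) ℂ)
    (φ : EE d → ℂ) (hc : Continuous φ) (hi : Integrable φ) (hFi : Integrable (𝓕 φ)) :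
    ‖∫ x, WW μ f x * φ x‖ₑ ≤
      (∫⁻ ξ, ‖𝓕 (f : EE d → ℂ) ξ‖ₑ ^ 2 * ENNReal.ofReal (‖ξ‖ ^ ((d:ℝ) - 2 * μ))) ^ (1/2 : ℝ) *
        (∫⁻ ξ, ‖𝓕 φ ξ‖ₑ ^ 2 * ENNReal.ofReal (‖ξ‖ ^ (-((d:ℝ) - 2 * μ)))) ^ (1/2 : ℝ) := by
  have hs : (d:ℝ) - 2 * μ = 0 := by rw [h2]; ring
  rw [hs]
  simp only [neg_zero, Real.rpow_zero, ENNReal.ofReal_one, mul_one]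
  rw [← plancherel_nice hc hi hFi,
    ← plancherel_nice f.continuous f.integrable (schwartz_fourier_int f)]
  have e : ∫⁻ x, ‖f x‖ₑ ^ 2 = ∫⁻ x, ‖WW μ f x‖ₑ ^ 2 := by
    rw [← lintegral_sig hd]
    refine lintegral_congr fun x => ?_
    rw [WW, enorm_mul, mul_pow, ← ofReal_norm (((_ : ℝ)) : ℂ), Complex.norm_real,
      Real.norm_of_nonneg (by positivity), ← ENNReal.ofReal_pow (by positivity),
      ← Real.rpow_natCast, ← Real.rpow_mul (norm_nonneg _)]
    congr 3
    rw [h2]; push_cast; ring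
  rw [e]
  have hm := measurable_WW μ f.continuous.measurable
  have hm2 := hc.measurable
  calc _ ≤ ∫⁻ x, ‖WW μ f x * φ x‖ₑ := enorm_integral_le_lintegral_enorm _
    _ = ∫⁻ x, ‖WW μ f x‖ₑ * ‖φ x‖ₑ := by simp_rw [enorm_mul]
    _ ≤ _ := lintegral_CS (by fun_prop) (by fun_prop)

lemma weyl_le (hd : 1 ≤ d) {μ : ℝ} (hμ : 0 < μ) (hμ' : μ < d) (f : SchwartzMap (EE d) ℂ) :
    ∫⁻ ξ, ‖𝓕 (WW μ f) ξ‖ₑ ^ 2 * ENNReal.ofReal (‖ξ‖ ^ ((d:ℝ) - 2 * μ)) ≤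
      ∫⁻ ξ, ‖𝓕 (f : EE d → ℂ) ξ‖ₑ ^ 2 * ENNReal.ofReal (‖ξ‖ ^ ((d:ℝ) - 2 * μ)) := by
  by_cases hW : Integrable (WW μ f)
  · rcases lt_trichotomy μ (d / 2) with h | h | h
    · exact dual_full hW hd _ (dual_pos hd hμ h f)
    · exact dual_full hW hd _ (dual_zero hd h f)
    · exact (weyl_isometry_neg hd h hμ' f.integrable f.continuous.measurable
        (bdd_of_inv f.continuous f.integrable (schwartz_fourier_int f))).le
  · have : ∀ ξ, 𝓕 (WW μ f) ξ = 0 := by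
      intro ξ
      rw [Real.fourier_eq]
      refine integral_undef fun h => hW ?_
      exact (Real.fourierIntegral_convergent_iff ξ).1 h
    simp [this]


end Helpers

/-- The action `(wf)(x) = |x|^{-2μ} f(-x/|x|²)` of the Weyl element on the complementary
series space with norm `‖f‖²_μ = ∫ |𝓕f(ξ)|² |ξ|^{d-2μ} dξ` is bounded, for `0 < μ < d`. -/
theorem weyl_inversion_bounded (d : ℕ) (hd : 1 ≤ d) (μ : ℝ) (hμ : 0 < μ) (hμ' : μ < d) :
    ∃ C : ℝ≥0, 0 < C ∧ ∀ f : SchwartzMap (EuclideanSpace ℝ (Fin d)) ℂ,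
      ∫⁻ ξ : EuclideanSpace ℝ (Fin d),
          (‖𝓕 (fun x : EuclideanSpace ℝ (Fin d) =>
              (↑(‖x‖ ^ (-(2 * μ))) : ℂ) * f (-((‖x‖ ^ 2)⁻¹ • x))) ξ‖₊ : ℝ≥0∞) ^ 2
            * ENNReal.ofReal (‖ξ‖ ^ ((d : ℝ) - 2 * μ))
        ≤ C * ∫⁻ ξ : EuclideanSpace ℝ (Fin d),
            (‖𝓕 (⇑f) ξ‖₊ : ℝ≥0∞) ^ 2 * ENNReal.ofReal (‖ξ‖ ^ ((d : ℝ) - 2 * μ)) := by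
  refine ⟨1, one_pos, fun f => ?_⟩
  rw [ENNReal.coe_one, one_mul]
  exact weyl_le hd hμ hμ' f
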